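/- arXiv:2406.16856 — 2 statements merged into one kernel-verified Lean document; each statement's English description precedes it below -/
import Mathlib

section
/- If {□_A, □_B} is a balanced two-element partition of a rectangle □ (with positive side lengths), then |□_A| > (2/27)·|□| and |□_B| > (2/27)·|□|, where |·| denotes the area. -/
/-- The eccentricity of a rectangle with side lengths `w` and `h`: the ratio of the longer side
to the shorter side. -/
noncomputable def ecc (w h : ℝ) : ℝ := max w h / min w h

/-- `{□_A, □_B}` (with side lengths `(wA, hA)` and `(wB, hB)`) is a balanced two-element
partition of the rectangle `□` with side lengths `(w, h)`: it is either a vertical or a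
horizontal cut, and `max(E(□_A), E(□_B)) ≤ max(3, 2·E(□)/3)`. -/
def IsBalancedSplit (w h wA hA wB hB : ℝ) : Prop :=
  (0 < wA ∧ 0 < hA ∧ 0 < wB ∧ 0 < hB) ∧
  ((wA + wB = w ∧ hA = h ∧ hB = h) ∨ (hA + hB = h ∧ wA = w ∧ wB = w)) ∧
  max (ecc wA hA) (ecc wB hB) ≤ max 3 (2 * ecc w h / 3)

theorem ecc_eq_max_div {w h : ℝ} (hw : 0 < w) (hh : 0 < h) : ecc w h = max (w / h) (h / w) := by
  unfold ecc
  rcases le_total w h with hle | hle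
  · rw [max_eq_right hle, min_eq_left hle, max_eq_right]
    exact ((div_le_one hh).2 hle).trans ((one_le_div hw).2 hle)
  · rw [max_eq_left hle, min_eq_right hle, max_eq_left]
    exact ((div_le_one hw).2 hle).trans ((one_le_div hh).2 hle)

theorem ecc_comm (w h : ℝ) : ecc w h = ecc h w := by
  rw [ecc, ecc, max_comm, min_comm]

/-- If cutting the side `x + y` gives pieces of bounded eccentricity, then `x` is a substantial
part of that side. -/
theorem lt_of_ecc_le {x y h : ℝ} (hx : 0 < x) (hy : 0 < y) (hh : 0 < h)
    (hxe : ecc x h ≤ max 3 (2 * ecc (x + y) h / 3))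
    (hye : ecc y h ≤ max 3 (2 * ecc (x + y) h / 3)) : 2 / 27 * (x + y) < x := by
  have hw : 0 < x + y := add_pos hx hy
  have h_div : h / x ≤ ecc x h := by
    rw [ecc_eq_max_div hx hh]
    exact le_max_right _ _
  have y_div : y / h ≤ ecc y h := by
    rw [ecc_eq_max_div hy hh]
    exact le_max_left _ _
  have hxb := h_div.trans hxe
  have hyb := y_div.trans hye
  rcases max_choice 3 (2 * ecc (x + y) h / 3) with hm | hm
  · rw [hm, div_le_iff₀ hx] at hxb
    rw [hm, div_le_iff₀ hh] at hyb
    linarith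
  · rw [hm] at hxb hyb
    rw [ecc_eq_max_div hw hh] at hxb hyb
    rcases max_choice ((x + y) / h) (h / (x + y)) with hc | hc
    · rw [hc, div_le_iff₀ hh] at hyb
      have : 2 * ((x + y) / h) / 3 * h = 2 * (x + y) / 3 := by field_simp
      linarith
    · rw [hc, div_le_iff₀ hx] at hxb
      have : 2 * (h / (x + y)) / 3 * x < h := by
        rw [show 2 * (h / (x + y)) / 3 * x = 2 * h * x / (3 * (x + y)) by field_simp,
          div_lt_iff₀ (by positivity)]
        nlinarith [mul_pos hh hx, mul_pos hh hy]
      linarith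

theorem mul_lt_mul_of_ecc_le {x y h : ℝ} (hx : 0 < x) (hy : 0 < y) (hh : 0 < h)
    (he : max (ecc x h) (ecc y h) ≤ max 3 (2 * ecc (x + y) h / 3)) :
    2 / 27 * ((x + y) * h) < x * h ∧ 2 / 27 * ((x + y) * h) < y * h := by
  obtain ⟨hxe, hye⟩ := max_le_iff.1 he
  have hA := lt_of_ecc_le hx hy hh hxe hye
  have hB := lt_of_ecc_le hy hx hh (by rwa [add_comm y x]) (by rwa [add_comm y x])
  rw [add_comm y x] at hB
  rw [← mul_assoc]
  exact ⟨mul_lt_mul_of_pos_right hA hh, mul_lt_mul_of_pos_right hB hh⟩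

/-- If `{□_A, □_B}` is a balanced partition of a rectangle `□` with positive side lengths, then
each part has area greater than `(2/27)` times the area of `□`. -/
theorem balanced_partition_area (w h wA hA wB hB : ℝ) (hw : 0 < w) (hh : 0 < h)
    (hbal : IsBalancedSplit w h wA hA wB hB) :
    2 / 27 * (w * h) < wA * hA ∧ 2 / 27 * (w * h) < wB * hB := by
  obtain ⟨⟨hwA, hhA, hwB, hhB⟩, ⟨rfl, rfl, rfl⟩ | ⟨rfl, rfl, rfl⟩, he⟩ := hbal
  · exact mul_lt_mul_of_ecc_le hwA hwB hh he
  · simp only [ecc_comm wB] at he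
    simpa only [mul_comm] using mul_lt_mul_of_ecc_le hhA hhB hw he
end

section
/- Let (t : 𝔥 → 𝔤, ρ) be a differential crossed module of Lie algebras over a field k, and let (I, J) be a crossed ideal, i.e., I ⊆ 𝔥 and J ⊆ 𝔤 are Lie ideals such that t(I) ⊆ J, ρ_x(I) ⊆ I for all x ∈ 𝔤, and ρ_x(𝔥) ⊆ I for all x ∈ J. Then there exists a unique differential crossed module structure (t' : 𝔥/I → 𝔤/J, ρ') on the quotient Lie algebras such that the canonical projections ψ : 𝔥 → 𝔥/I and φ : 𝔤 → 𝔤/J form a morphism of crossed modules, i.e., φ ∘ t = t' ∘ ψ and ψ(ρ_x(h)) = ρ'_{φ(x)}(ψ(h)) for all x ∈ 𝔤 and h ∈ 𝔥. -/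
section LieQuotient

variable {k L L' : Type*} [CommRing k] [LieRing L] [LieAlgebra k L] [LieRing L'] [LieAlgebra k L']

/-- A Lie algebra homomorphism vanishing on an ideal descends to the quotient. -/
def LieIdeal.quotientLift (I : LieIdeal k L) (f : L →ₗ⁅k⁆ L') (hf : ∀ a ∈ I, f a = 0) :
    (L ⧸ I) →ₗ⁅k⁆ L' :=
  { I.toSubmodule.liftQ (f : L →ₗ[k] L') hf with
    map_lie' := by
      rintro ⟨x⟩ ⟨y⟩
      exact f.map_lie x y }

/-- The projection onto the quotient by an ideal, as a Lie algebra homomorphism. -/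
def LieIdeal.quotientMk (I : LieIdeal k L) : L →ₗ⁅k⁆ L ⧸ I :=
  { I.toSubmodule.mkQ with
    map_lie' := rfl }

/-- A Lie derivation preserving an ideal descends to the quotient. -/
def LieDerivation.quotient (I : LieIdeal k L) (D : LieDerivation k L L) (hD : ∀ a ∈ I, D a ∈ I) :
    LieDerivation k (L ⧸ I) (L ⧸ I) :=
  { I.toSubmodule.mapQ I.toSubmodule (D : L →ₗ[k] L) hD with
    leibniz' := by
      rintro ⟨a⟩ ⟨b⟩
      exact congrArg I.quotientMk (D.leibniz' a b) }

/-- A Lie algebra action by derivations preserving an ideal descends to the quotient. -/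
def LieHom.quotientAction (I : LieIdeal k L) (ρ : L' →ₗ⁅k⁆ LieDerivation k L L)
    (hρ : ∀ x, ∀ a ∈ I, ρ x a ∈ I) : L' →ₗ⁅k⁆ LieDerivation k (L ⧸ I) (L ⧸ I) where
  toFun x := (ρ x).quotient I (hρ x)
  map_add' x y := by
    ext ⟨a⟩
    exact congrArg I.quotientMk (DFunLike.congr_fun (ρ.map_add x y) a)
  map_smul' c x := by
    ext ⟨a⟩
    exact congrArg I.quotientMk (DFunLike.congr_fun (ρ.map_smul c x) a)
  map_lie' := by
    intro x y
    ext ⟨a⟩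
    exact congrArg I.quotientMk
      ((DFunLike.congr_fun (ρ.map_lie x y) a).trans (LieDerivation.commutator_apply ..))

end LieQuotient

/-- Quotient of a differential crossed module of Lie algebras by a crossed ideal `(I, J)`:
there is a unique differential crossed module structure on `(𝔥/I, 𝔤/J)` such that the canonical
projections form a morphism of crossed modules. -/
theorem quotient_by_crossed_ideal {k H G : Type*} [Field k]
    [LieRing H] [LieAlgebra k H] [LieRing G] [LieAlgebra k G]
    (t : H →ₗ⁅k⁆ G) (ρ : G →ₗ⁅k⁆ LieDerivation k H H)
    (hequiv : ∀ (x : G) (h : H), t ((ρ x) h) = ⁅x, t h⁆)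
    (hpeiffer : ∀ h h' : H, (ρ (t h)) h' = ⁅h, h'⁆)
    (I : LieIdeal k H) (J : LieIdeal k G)
    (htIJ : ∀ a ∈ I, t a ∈ J)
    (hactI : ∀ x : G, ∀ a ∈ I, (ρ x) a ∈ I)
    (hactJ : ∀ x ∈ J, ∀ a : H, (ρ x) a ∈ I) :
    ∃! p : ((H ⧸ I) →ₗ⁅k⁆ (G ⧸ J)) × ((G ⧸ J) →ₗ⁅k⁆ LieDerivation k (H ⧸ I) (H ⧸ I)),
      -- the canonical projections form a morphism of crossed modules
      (∀ h : H,
        p.1 (LieSubmodule.Quotient.mk (N := I) h) =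
          LieSubmodule.Quotient.mk (N := J) (t h)) ∧
      (∀ (x : G) (h : H),
        (p.2 (LieSubmodule.Quotient.mk (N := J) x)) (LieSubmodule.Quotient.mk (N := I) h) =
          LieSubmodule.Quotient.mk (N := I) ((ρ x) h)) ∧
      -- and `(p.1, p.2)` is a differential crossed module structure
      (∀ (x : G ⧸ J) (h : H ⧸ I), p.1 ((p.2 x) h) = ⁅x, p.1 h⁆) ∧
      (∀ h h' : H ⧸ I, (p.2 (p.1 h)) h' = ⁅h, h'⁆) := by
  refine ⟨(I.quotientLift (J.quotientMk.comp t) fun a ha =>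
      LieSubmodule.Quotient.mk_eq_zero'.mpr (htIJ a ha),
    J.quotientLift (LieHom.quotientAction I ρ hactI) ?_), ⟨?_, ?_, ?_, ?_⟩, ?_⟩
  · intro x hx
    ext ⟨a⟩
    exact LieSubmodule.Quotient.mk_eq_zero'.mpr (hactJ x hx a)
  · exact fun _ => rfl
  · exact fun _ _ => rfl
  · rintro ⟨x⟩ ⟨h⟩
    exact congrArg J.quotientMk (hequiv x h)
  · rintro ⟨h⟩ ⟨h'⟩
    exact congrArg I.quotientMk (hpeiffer h h')
  · rintro ⟨t', ρ'⟩ ⟨ht', hρ', -, -⟩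
    refine Prod.ext ?_ ?_
    · ext ⟨h⟩
      exact ht' h
    · ext ⟨x⟩ ⟨h⟩
      exact hρ' x h
end
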